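/- Let p be an ultrafilter on ℕ, let (x_i)_{i∈ℕ} be a sequence in ℝ^d, and let h : ℕ → ℝ^d be a generalised polynomial. Then the map ℕ → ℝ given by n ↦ 1 if ⟨h(n), x_i⟩ ≥ 0 for p-almost all i, and n ↦ 0 otherwise, is a generalised polynomial on ℕ. Here ⟨·,·⟩ is the standard inner product on ℝ^d. -/

import Mathlib

/-- Generalised polynomial maps `ℝ^d → ℝ`: the smallest family containing coordinate
maps and constants, closed under addition, multiplication and integer part. -/
inductive IsGenPoly {d : ℕ} : ((Fin d → ℝ) → ℝ) → Prop
  | coord (i : Fin d) : IsGenPoly (fun x => x i)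
  | const (c : ℝ) : IsGenPoly (fun _ => c)
  | add {f g : (Fin d → ℝ) → ℝ} : IsGenPoly f → IsGenPoly g →
      IsGenPoly (fun x => f x + g x)
  | mul {f g : (Fin d → ℝ) → ℝ} : IsGenPoly f → IsGenPoly g →
      IsGenPoly (fun x => f x * g x)
  | intPart {f : (Fin d → ℝ) → ℝ} : IsGenPoly f →
      IsGenPoly (fun x => (⌊f x⌋ : ℝ))

/-- A generalised polynomial on `ℕ`: the restriction to `ℕ` of a generalised
polynomial `ℝ → ℝ`. -/
def IsGenPolyNat (g : ℕ → ℝ) : Prop :=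
  ∃ f : (Fin 1 → ℝ) → ℝ, IsGenPoly f ∧ ∀ n : ℕ, g n = f (fun _ => (n : ℝ))

/-- A generalised polynomial subset of `ℕ`: the zero set of a generalised polynomial. -/
def IsGenPolySet (E : Set ℕ) : Prop :=
  ∃ g : ℕ → ℝ, IsGenPolyNat g ∧ E = {n : ℕ | g n = 0}

open scoped Classical

namespace IsGenPolyNat

theorem const (c : ℝ) : IsGenPolyNat (fun _ => c) :=
  ⟨_, .const c, fun _ => rfl⟩

theorem natCast : IsGenPolyNat (fun n => (n : ℝ)) :=
  ⟨_, .coord 0, fun _ => rfl⟩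

theorem add {f g : ℕ → ℝ} (hf : IsGenPolyNat f) (hg : IsGenPolyNat g) :
    IsGenPolyNat (fun n => f n + g n) := by
  obtain ⟨F, hF, hF'⟩ := hf
  obtain ⟨G, hG, hG'⟩ := hg
  exact ⟨_, hF.add hG, fun n => by simp only [hF', hG']⟩

theorem mul {f g : ℕ → ℝ} (hf : IsGenPolyNat f) (hg : IsGenPolyNat g) :
    IsGenPolyNat (fun n => f n * g n) := by
  obtain ⟨F, hF, hF'⟩ := hf
  obtain ⟨G, hG, hG'⟩ := hg
  exact ⟨_, hF.mul hG, fun n => by simp only [hF', hG']⟩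

theorem floor {f : ℕ → ℝ} (hf : IsGenPolyNat f) : IsGenPolyNat (fun n => (⌊f n⌋ : ℝ)) := by
  obtain ⟨F, hF, hF'⟩ := hf
  exact ⟨_, hF.intPart, fun n => by simp only [hF']⟩

theorem neg {f : ℕ → ℝ} (hf : IsGenPolyNat f) : IsGenPolyNat (fun n => -f n) := by
  simpa using (const (-1)).mul hf

theorem sub {f g : ℕ → ℝ} (hf : IsGenPolyNat f) (hg : IsGenPolyNat g) :
    IsGenPolyNat (fun n => f n - g n) := by
  simpa [sub_eq_add_neg] using hf.add hg.neg

theorem fract {f : ℕ → ℝ} (hf : IsGenPolyNat f) : IsGenPolyNat (fun n => Int.fract (f n)) :=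
  hf.sub hf.floor

theorem sum {ι : Type*} (s : Finset ι) {f : ι → ℕ → ℝ} (hf : ∀ j ∈ s, IsGenPolyNat (f j)) :
    IsGenPolyNat (fun n => ∑ j ∈ s, f j n) := by
  induction s using Finset.induction_on with
  | empty => simpa using const 0
  | insert a s ha ih =>
    simp only [Finset.sum_insert ha]
    exact (hf a (by simp)).add (ih fun j hj => hf j (by simp [hj]))

/-- For an integer `m`, the integer part of `1 - {√2 m}` is the indicator of `m = 0`. -/
theorem indicator_eq_zero {m : ℕ → ℤ} (hm : IsGenPolyNat (fun n => (m n : ℝ))) :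
    IsGenPolyNat (fun n => if m n = 0 then (1 : ℝ) else 0) := by
  convert ((const 1).sub ((const √2).mul hm).fract).floor using 2 with n
  split_ifs with h
  · simp [h]
  · have hirr : Irrational (√2 * m n) := irrational_sqrt_two.mul_intCast h
    have hpos : 0 < Int.fract (√2 * m n) := by
      refine (Int.fract_nonneg _).lt_of_ne' fun h0 => ?_
      obtain ⟨z, hz⟩ := Int.fract_eq_zero_iff.1 h0
      exact hirr.ne_int z hz.symm
    have hfl : ⌊1 - Int.fract (√2 * m n)⌋ = 0 := by
      rw [Int.floor_eq_zero_iff]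
      exact ⟨by linarith [Int.fract_lt_one (√2 * m n)], by linarith⟩
    simp [hfl]

/-- The indicator of `⌊g n⌋ ∈ s`, for a finite set `s` of integers. -/
theorem indicator_floor_mem {g : ℕ → ℝ} (hg : IsGenPolyNat g) (s : Finset ℤ) :
    IsGenPolyNat (fun n => if ⌊g n⌋ ∈ s then (1 : ℝ) else 0) := by
  have hs : IsGenPolyNat (fun n => ∑ j ∈ s, if ⌊g n⌋ - j = 0 then (1 : ℝ) else 0) :=
    sum s fun j _ => indicator_eq_zero (m := fun n => ⌊g n⌋ - j) (by
      simpa using hg.floor.sub (const (j : ℝ)))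
  simpa [sub_eq_zero] using hs

end IsGenPolyNat

/-- Sequences of the form `∑ i, n ^ i * b i n` with `b i` bounded generalised polynomials. -/
inductive IsPolyInBounded : (ℕ → ℝ) → Prop
  | zero : IsPolyInBounded (fun _ => 0)
  | step {g c : ℕ → ℝ} : IsPolyInBounded g → IsGenPolyNat c → (∃ C : ℕ, ∀ n, |c n| ≤ C) →
      IsPolyInBounded (fun n => n * g n + c n)

namespace IsPolyInBounded

theorem of_bounded {c : ℕ → ℝ} (hc : IsGenPolyNat c) (hb : ∃ C : ℕ, ∀ n, |c n| ≤ C) :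
    IsPolyInBounded c := by
  simpa using zero.step hc hb

theorem isGenPolyNat {g : ℕ → ℝ} (hg : IsPolyInBounded g) : IsGenPolyNat g := by
  induction hg with
  | zero => exact .const 0
  | step _ hc _ ih => exact (IsGenPolyNat.natCast.mul ih).add hc

theorem add {f g : ℕ → ℝ} (hf : IsPolyInBounded f) (hg : IsPolyInBounded g) :
    IsPolyInBounded (fun n => f n + g n) := by
  induction hf generalizing g with
  | zero => simpa using hg
  | @step f c hf hc hb ih =>
    cases hg with
    | zero => simpa using hf.step hc hb
    | @step g e hg he hb' =>
      obtain ⟨C, hC⟩ := hb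
      obtain ⟨E, hE⟩ := hb'
      have := (ih hg).step (hc.add he)
        ⟨C + E, fun n => (abs_add_le _ _).trans (by push_cast; exact add_le_add (hC n) (hE n))⟩
      convert this using 2
      ring

theorem natCast_mul {g : ℕ → ℝ} (hg : IsPolyInBounded g) :
    IsPolyInBounded (fun n => n * g n) := by
  simpa using hg.step (.const 0) ⟨0, by simp⟩

theorem bounded_mul {c g : ℕ → ℝ} (hc : IsGenPolyNat c) (hb : ∃ C : ℕ, ∀ n, |c n| ≤ C)
    (hg : IsPolyInBounded g) : IsPolyInBounded (fun n => c n * g n) := by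
  induction hg with
  | zero => simpa using zero
  | @step g e hg he hb' ih =>
    obtain ⟨C, hC⟩ := hb
    obtain ⟨E, hE⟩ := hb'
    have := ih.step (hc.mul he) ⟨C * E, fun n => by
      rw [abs_mul]; push_cast
      exact mul_le_mul (hC n) (hE n) (abs_nonneg _) (by positivity)⟩
    convert this using 2
    ring

theorem mul {f g : ℕ → ℝ} (hf : IsPolyInBounded f) (hg : IsPolyInBounded g) :
    IsPolyInBounded (fun n => f n * g n) := by
  induction hf with
  | zero => simpa using zero
  | @step f c hf hc hb ih =>
    convert ih.natCast_mul.add (bounded_mul hc hb hg) using 2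
    ring

theorem floor {f : ℕ → ℝ} (hf : IsPolyInBounded f) :
    IsPolyInBounded (fun n => (⌊f n⌋ : ℝ)) := by
  have hb : IsPolyInBounded (fun n => -Int.fract (f n)) :=
    of_bounded hf.isGenPolyNat.fract.neg ⟨1, fun n => by
      rw [abs_neg, Int.abs_fract]; exact_mod_cast (Int.fract_lt_one (f n)).le⟩
  convert hf.add hb using 2 with n
  linarith [Int.floor_add_fract (f n)]

theorem indicator_nonneg {g : ℕ → ℝ} (hg : IsPolyInBounded g) :
    IsGenPolyNat (fun n => if 0 ≤ g n then (1 : ℝ) else 0) := by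
  induction hg with
  | zero => simpa using .const 1
  | @step g c hg hc hb ih =>
    obtain ⟨C, hC⟩ := hb
    have hf : IsGenPolyNat (fun n => n * g n + c n) := (hg.step hc ⟨C, hC⟩).isGenPolyNat
    convert (ih.mul ((IsGenPolyNat.const 1).sub (hf.indicator_floor_mem (Finset.Ico (-C) 0)))).add
      (((IsGenPolyNat.const 1).sub ih).mul (hf.indicator_floor_mem (Finset.Icc 0 C))) using 2 with n
    have hc' := abs_le.1 (hC n)
    have hn : (0 : ℝ) ≤ n := n.cast_nonneg
    by_cases h : 0 ≤ g n
    · have hlow : -(C : ℤ) ≤ ⌊n * g n + c n⌋ := by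
        rw [Int.le_floor]; push_cast; nlinarith [mul_nonneg hn h]
      by_cases h' : 0 ≤ n * g n + c n
      · have hmem : ⌊n * g n + c n⌋ ∉ Finset.Ico (-(C : ℤ)) 0 := fun hm =>
          (Finset.mem_Ico.1 hm).2.not_ge (Int.floor_nonneg.2 h')
        rw [if_pos h, if_pos h', if_neg hmem]
        norm_num
      · have hmem : ⌊n * g n + c n⌋ ∈ Finset.Ico (-(C : ℤ)) 0 :=
          Finset.mem_Ico.2 ⟨hlow, not_le.1 (mt Int.floor_nonneg.1 h')⟩
        rw [if_pos h, if_neg h', if_pos hmem]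
        norm_num
    · have hup : ⌊n * g n + c n⌋ ≤ (C : ℤ) := by
        rw [Int.floor_le_iff]; push_cast
        nlinarith [mul_nonneg hn (neg_nonneg.2 (not_le.1 h).le)]
      simp [h, hup, Int.floor_nonneg]

end IsPolyInBounded

theorem IsGenPolyNat.isPolyInBounded {g : ℕ → ℝ} (hg : IsGenPolyNat g) : IsPolyInBounded g := by
  obtain ⟨f, hf, hgf⟩ := hg
  obtain rfl : g = fun n : ℕ => f (fun _ => (n : ℝ)) := funext hgf
  clear hgf
  have hconst (c : ℝ) : IsPolyInBounded (fun _ => c) :=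
    .of_bounded (.const c) ⟨⌈|c|⌉₊, fun _ => Nat.le_ceil _⟩
  induction hf with
  | coord i => simpa using (hconst 1).natCast_mul
  | const c => exact hconst c
  | add _ _ ihf ihg => exact ihf.add ihg
  | mul _ _ ihf ihg => exact ihf.mul ihg
  | intPart _ ih => exact ih.floor

theorem IsGenPolyNat.indicator_nonneg {g : ℕ → ℝ} (hg : IsGenPolyNat g) :
    IsGenPolyNat (fun n => if 0 ≤ g n then (1 : ℝ) else 0) :=
  hg.isPolyInBounded.indicator_nonneg

/-- A real sequence bounded along an ultrafilter converges along it. -/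
theorem Ultrafilter.exists_tendsto_of_eventually_abs_le {α : Type*} (p : Ultrafilter α)
    {u : α → ℝ} {C : ℝ} (hu : ∀ᶠ i in p, |u i| ≤ C) :
    ∃ y, Filter.Tendsto u p (nhds y) := by
  obtain ⟨y, -, hy⟩ := (isCompact_Icc (a := -C) (b := C)).ultrafilter_le_nhds (p.map u) (by
    rw [Filter.le_principal_iff]
    exact hu.mono fun i hi => abs_le.1 hi)
  exact ⟨y, hy⟩

/-- A perturbation of a number `L` by an infinitesimal matters for the sign only if `L = 0`. -/
theorem Ultrafilter.eventually_nonneg_add_iff {α : Type*} (p : Ultrafilter α) (L : ℝ)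
    {u : α → ℝ} (hu : Filter.Tendsto u p (nhds 0)) :
    (∀ᶠ i in p, 0 ≤ L + u i) ↔ 0 ≤ L ∧ (0 ≤ -L → ∀ᶠ i in p, 0 ≤ u i) := by
  have hlim : Filter.Tendsto (fun i => L + u i) p (nhds L) := by simpa using hu.const_add L
  rcases lt_trichotomy L 0 with hL | rfl | hL
  · have hneg := hlim.eventually_lt_const hL
    refine iff_of_false (fun h => ?_) (fun h => hL.not_ge h.1)
    obtain ⟨i, hi, hi'⟩ := (h.and hneg).exists
    exact hi'.not_ge hi
  · simp
  · refine iff_of_true ?_ ⟨hL.le, fun h => absurd h (by linarith)⟩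
    filter_upwards [hlim.eventually_const_lt hL] with i hi using hi.le

theorem indicator_eventually_sum_nonneg {ι : Type*} (p : Ultrafilter ℕ) {h : ℕ → ι → ℝ}
    (hh : ∀ j, IsGenPolyNat (fun n => h n j)) (s : Finset ι) (x : ℕ → ι → ℝ) :
    IsGenPolyNat (fun n => if ∀ᶠ i in p, 0 ≤ ∑ j ∈ s, h n j * x i j then (1 : ℝ) else 0) := by
  induction s using Finset.strongInduction generalizing x with
  | H s ih =>
  rcases s.eq_empty_or_nonempty with rfl | hs
  · simpa using .const 1
  have hmax : ∀ᶠ i in p, ∃ j ∈ (s : Set ι), ∀ k ∈ s, |x i k| ≤ |x i j| :=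
    .of_forall fun i => s.exists_max_image (fun k => |x i k|) hs
  rw [Ultrafilter.eventually_exists_mem_iff s.finite_toSet] at hmax
  obtain ⟨j, hj, hmax⟩ := hmax
  rw [Finset.mem_coe] at hj
  by_cases h0 : ∀ᶠ i in p, x i j = 0
  · have (n : ℕ) : ∀ᶠ i in p, 0 ≤ ∑ k ∈ s, h n k * x i k := by
      filter_upwards [h0, hmax] with i hi hm
      refine Finset.sum_nonneg fun k hk => ?_
      have hk0 : x i k = 0 := abs_nonpos_iff.1 (by simpa [hi] using hm k hk)
      simp [hk0]
    simpa [this] using .const 1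
  rw [← Ultrafilter.eventually_not] at h0
  let w : ℕ → ι → ℝ := fun i k => x i k / |x i j|
  have hlim (k : ι) (hk : k ∈ s) : ∃ y, Filter.Tendsto (fun i => w i k) p (nhds y) := by
    refine p.exists_tendsto_of_eventually_abs_le (C := 1) ?_
    filter_upwards [hmax] with i hm
    rw [abs_div, abs_abs]
    exact div_le_one_of_le₀ (hm k hk) (abs_nonneg _)
  choose! y hy using hlim
  have hwj : ∀ᶠ i in p, w i j = y j := by
    have hsign : (∀ᶠ i in p, w i j = 1) ∨ ∀ᶠ i in p, w i j = -1 := by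
      rw [← Ultrafilter.eventually_or]
      filter_upwards [h0] with i hi
      rcases lt_or_gt_of_ne hi with hneg | hpos
      · right
        simp only [w, abs_of_neg hneg, div_neg, div_self hi]
      · left
        simp only [w, abs_of_pos hpos, div_self hi]
    rcases hsign with he | he <;>
    · rw [tendsto_nhds_unique (hy j hj) (tendsto_const_nhds.congr' (he.mono fun _ => Eq.symm))]
      exact he
  have hL : IsGenPolyNat (fun n => ∑ k ∈ s, h n k * y k) :=
    .sum s fun k _ => (hh k).mul (.const _)
  have key (n : ℕ) : (∀ᶠ i in p, 0 ≤ ∑ k ∈ s, h n k * x i k) ↔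
      0 ≤ ∑ k ∈ s, h n k * y k ∧ (0 ≤ -∑ k ∈ s, h n k * y k →
        ∀ᶠ i in p, 0 ≤ ∑ k ∈ s.erase j, h n k * (w i k - y k)) := by
    rw [← p.eventually_nonneg_add_iff]
    · refine Filter.eventually_congr ?_
      filter_upwards [h0, hwj] with i hi hij
      have hpos : 0 < |x i j| := abs_pos.2 hi
      have hz : ∑ k ∈ s.erase j, h n k * (w i k - y k) = ∑ k ∈ s, h n k * (w i k - y k) :=
        Finset.sum_erase _ (by simp [hij])
      have hw : ∑ k ∈ s, h n k * w i k = (∑ k ∈ s, h n k * x i k) / |x i j| := by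
        simp only [w, Finset.sum_div, mul_div_assoc]
      rw [hz, ← Finset.sum_add_distrib]
      simp only [← mul_add, add_sub_cancel]
      rw [hw, le_div_iff₀ hpos, zero_mul]
    · have := tendsto_finsetSum (s.erase j) fun k hk =>
        ((hy k (Finset.mem_of_mem_erase hk)).sub_const (y k)).const_mul (h n k)
      simpa using this
  convert hL.indicator_nonneg.mul ((IsGenPolyNat.const 1).sub (hL.neg.indicator_nonneg.mul
    ((IsGenPolyNat.const 1).sub (ih (s.erase j) (Finset.erase_ssubset hj)
      fun i k => w i k - y k)))) using 2 with n
  rw [if_congr (key n) rfl rfl]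
  split_ifs <;> first | (norm_num; done) | (exfalso; tauto)

/-- For an ultrafilter `p` on `ℕ`, a sequence `(x_i)` in `ℝ^d`, and a
generalised polynomial `h : ℕ → ℝ^d`, the indicator of
`{n : ⟨h(n), x_i⟩ ≥ 0 for p-almost all i}` is a generalised polynomial on `ℕ`. -/
theorem indicator_inner_nonneg_genPoly (d : ℕ) (p : Ultrafilter ℕ)
    (x : ℕ → (Fin d → ℝ)) (h : ℕ → (Fin d → ℝ))
    (hh : ∀ j : Fin d, IsGenPolyNat (fun n => h n j)) :
    IsGenPolyNat (fun n =>
      if {i : ℕ | 0 ≤ ∑ j, h n j * x i j} ∈ p then (1 : ℝ) else 0) := by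
  exact indicator_eventually_sum_nonneg p hh Finset.univ x
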